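/- (Separability of the optimal GOSPA actions) For N independent far-away Bernoulli components with existence probabilities r₁,…,r_N ∈ [0,1], define for each i the per-sensor costs c_i(0) = (c²/2)·t(r_i) and c_i(1) = (c²/2)·t(r_i·(1 − p_D)/(1 − r_i·p_D))·(1 − r_i·p_D) + s, and the total GOSPA cost C(a) = Σ_{i=1}^{N} c_i(a_i) for a ∈ {0,1}^N. Then â ∈ {0,1}^N minimizes C over {0,1}^N if and only if for every i, â_i minimizes c_i over {0,1}. Moreover, for s > 0, the action â_i = 1 is the unique minimizer of c_i if and only if 2s/(c²·p_D) < r_i < (c²/2 − s)/(c²·(1 − p_D/2)) and s < c²·p_D/4. -/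

import Mathlib

noncomputable section

/-- The piecewise function `t(r) = r` if `r < 1/2`, else `1 - r`. -/
def tfun (r : ℝ) : ℝ := if r < 1/2 then r else 1 - r

/-- No-measurement cost `c₀(r) = (c²/2)·t(r)`. -/
def costNoMeasure (c r : ℝ) : ℝ := c^2 / 2 * tfun r

/-- Measurement cost `c₁(r) = (c²/2)·t(r(1−p_D)/(1−r·p_D))·(1−r·p_D) + s`.
(When `r = p_D = 1`, the first summand is `0`, consistent with this formula.) -/
def costMeasure (c pD s r : ℝ) : ℝ :=
  c^2 / 2 * tfun (r * (1 - pD) / (1 - r * pD)) * (1 - r * pD) + s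

/-- Per-sensor cost of action `a ∈ {0,1}` (encoded as `Bool`). -/
def sensorCost (c pD s r : ℝ) (a : Bool) : ℝ :=
  if a then costMeasure c pD s r else costNoMeasure c r

lemma tfun_eq_min (x : ℝ) : tfun x = min x (1 - x) := by
  unfold tfun
  split_ifs with h
  · rw [min_eq_left (by linarith)]
  · rw [min_eq_right (by linarith)]

lemma tfun_posterior_mul {p r : ℝ} (hp0 : 0 < p) (hp1 : p ≤ 1) (hr0 : 0 ≤ r) (hr1 : r ≤ 1) :
    tfun (r * (1 - p) / (1 - r * p)) * (1 - r * p) = min (r * (1 - p)) (1 - r) := by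
  have hq : 0 ≤ 1 - r * p := by nlinarith
  rcases hq.eq_or_lt with h | h
  · have hr : r = 1 := by nlinarith
    subst hr
    have hp : p = 1 := by linarith
    simp [hp]
  · rw [tfun_eq_min, min_mul_of_nonneg _ _ hq, sub_mul, div_mul_cancel₀ _ h.ne']
    congr 1
    ring

lemma sensorCost_true_lt_false_iff {c p s r : ℝ} (hc : 0 < c) (hp0 : 0 < p) (hp1 : p ≤ 1)
    (hs : 0 < s) (hr0 : 0 ≤ r) (hr1 : r ≤ 1) :
    sensorCost c p s r true < sensorCost c p s r false ↔
      2 * s / (c^2 * p) < r ∧ r < (c^2 / 2 - s) / (c^2 * (1 - p / 2)) ∧ s < c^2 * p / 4 := by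
  have hk : 0 < c ^ 2 := by positivity
  have hd : 0 < c ^ 2 * (1 - p / 2) := mul_pos hk (by linarith)
  simp only [sensorCost, costMeasure, costNoMeasure, if_true, Bool.false_eq_true, if_false]
  rw [mul_assoc, tfun_posterior_mul hp0 hp1 hr0 hr1, tfun_eq_min, div_lt_iff₀ (by positivity),
    lt_div_iff₀ hd, mul_min_of_nonneg _ _ (by positivity : 0 ≤ c ^ 2 / 2),
    mul_min_of_nonneg _ _ (by positivity : 0 ≤ c ^ 2 / 2), lt_min_iff]
  constructor
  · rintro ⟨h₁, h₂⟩
    rcases min_choice (c ^ 2 / 2 * (r * (1 - p))) (c ^ 2 / 2 * (1 - r)) with h | h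
    · rw [h] at h₁ h₂
      have hlow : 2 * s < r * (c ^ 2 * p) := by linarith
      have hupp : r * (c ^ 2 * (1 - p / 2)) < c ^ 2 / 2 - s := by linarith
      refine ⟨hlow, hupp, ?_⟩
      have := mul_lt_mul_of_pos_right hlow (by linarith : 0 < 1 - p / 2)
      have := mul_lt_mul_of_pos_right hupp hp0
      linarith
    · rw [h] at h₂
      linarith
  · rintro ⟨h₁, h₂, -⟩
    have := min_le_left (c ^ 2 / 2 * (r * (1 - p))) (c ^ 2 / 2 * (1 - r))
    constructor <;> linarith

/-- A family minimizes a separable sum iff each coordinate minimizes its own summand. -/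
lemma forall_sum_le_sum_iff {ι α : Type*} [Fintype ι] (f : ι → α → ℝ) (x : ι → α) :
    (∀ y : ι → α, ∑ i, f i (x i) ≤ ∑ i, f i (y i)) ↔ ∀ i b, f i (x i) ≤ f i b := by
  classical
  refine ⟨fun h i b => ?_, fun h y => Finset.sum_le_sum fun i _ => h i (y i)⟩
  by_contra! hlt
  refine (h (Function.update x i b)).not_gt (Finset.sum_lt_sum (fun j _ => ?_)
    ⟨i, Finset.mem_univ i, by simpa using hlt⟩)
  rcases eq_or_ne j i with rfl | hj
  · simpa using hlt.le
  · simp [hj]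

/-- Separability of the optimal GOSPA actions: a joint action `â ∈ {0,1}^N`
minimizes the total cost `C(a) = Σᵢ cᵢ(aᵢ)` iff each component `âᵢ` minimizes
the per-sensor cost `cᵢ`; moreover, for `s > 0`, `âᵢ = 1` is the unique
minimizer of `cᵢ` iff `2s/(c²p_D) < rᵢ < (c²/2 − s)/(c²(1 − p_D/2))` and
`s < c²p_D/4`. -/
theorem gospa_separability (c pD s : ℝ) (hc : 0 < c) (hpD0 : 0 < pD) (hpD1 : pD ≤ 1)
    (hs : 0 ≤ s) (N : ℕ) (hN : 0 < N) (r : Fin N → ℝ)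
    (hr : ∀ i, 0 ≤ r i ∧ r i ≤ 1) :
    (∀ ahat : Fin N → Bool,
      ((∀ a : Fin N → Bool,
          ∑ i, sensorCost c pD s (r i) (ahat i) ≤ ∑ i, sensorCost c pD s (r i) (a i)) ↔
        ∀ i, ∀ b : Bool, sensorCost c pD s (r i) (ahat i) ≤ sensorCost c pD s (r i) b)) ∧
    (0 < s → ∀ i,
      (sensorCost c pD s (r i) true < sensorCost c pD s (r i) false ↔
        (2 * s / (c^2 * pD) < r i ∧ r i < (c^2 / 2 - s) / (c^2 * (1 - pD / 2)) ∧
          s < c^2 * pD / 4))) := by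
  exact ⟨fun ahat => forall_sum_le_sum_iff (fun i => sensorCost c pD s (r i)) ahat,
    fun hs i => sensorCost_true_lt_false_iff hc hpD0 hpD1 hs (hr i).1 (hr i).2⟩
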